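/- arXiv:1211.0910 — 9 statements merged into one kernel-verified Lean document; each statement's English description precedes it below -/
import Mathlib

section
/- For every prime power q ≥ 3, the graph B_q is q-regular, has exactly 2q^2 vertices, and has girth 6. -/
open SimpleGraph Sum

/-- The relation defining the incidence graph `B_q` of the biaffine plane over a finite
field `F`: `(x,y)₀` (in the left summand) is adjacent to `(m,b)₁` (in the right summand)
iff `y = m*x + b`. -/
def biaffineRel (F : Type) [Field F] :
    ((F × F) ⊕ (F × F)) → ((F × F) ⊕ (F × F)) → Prop
  | Sum.inl (x, y), Sum.inr (m, b) => y = m * x + b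
  | _, _ => False

/-- The graph `B_q`. -/
def biaffine (F : Type) [Field F] : SimpleGraph ((F × F) ⊕ (F × F)) :=
  SimpleGraph.fromRel (biaffineRel F)

/-- Degree of a vertex, as the cardinality of its neighbour set. -/
noncomputable def ndeg {V : Type} (G : SimpleGraph V) (v : V) : ℕ :=
  (G.neighborSet v).ncard

section Biaffine

variable {F : Type} [Field F]

@[simp] theorem biaffine_adj_inl_inr (p l : F × F) :
    (biaffine F).Adj (Sum.inl p) (Sum.inr l) ↔ p.2 = l.1 * p.1 + l.2 := by
  simp [biaffine, biaffineRel]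

@[simp] theorem biaffine_adj_inr_inl (p l : F × F) :
    (biaffine F).Adj (Sum.inr l) (Sum.inl p) ↔ p.2 = l.1 * p.1 + l.2 := by
  simp [biaffine, biaffineRel]

@[simp] theorem biaffine_not_adj_inl_inl (p p' : F × F) :
    ¬ (biaffine F).Adj (Sum.inl p) (Sum.inl p') := by
  simp [biaffine, biaffineRel]

@[simp] theorem biaffine_not_adj_inr_inr (l l' : F × F) :
    ¬ (biaffine F).Adj (Sum.inr l) (Sum.inr l') := by
  simp [biaffine, biaffineRel]

theorem ndeg_biaffine (v : (F × F) ⊕ (F × F)) : ndeg (biaffine F) v = Nat.card F := by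
  rcases v with ⟨x, y⟩ | ⟨m, b⟩
  · have h : (biaffine F).neighborSet (Sum.inl (x, y)) =
        (fun m : F => (Sum.inr (m, y - m * x) : (F × F) ⊕ (F × F))) '' Set.univ := by
      ext (p | ⟨m, b⟩)
      · simp
      · simp [sub_eq_iff_eq_add']
    rw [ndeg, h, Set.ncard_image_of_injective, Set.ncard_univ]
    intro m m' h
    simp_all
  · have h : (biaffine F).neighborSet (Sum.inr (m, b)) =
        (fun x : F => (Sum.inl (x, m * x + b) : (F × F) ⊕ (F × F))) '' Set.univ := by
      ext (⟨x, y⟩ | l)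
      · simp [eq_comm]
      · simp
    rw [ndeg, h, Set.ncard_image_of_injective, Set.ncard_univ]
    intro x x' h
    simp_all

/-- Two distinct points lie on at most one common line of the biaffine plane. -/
theorem biaffine_eq_or_eq {p p' l l' : F × F} (h₁ : p.2 = l.1 * p.1 + l.2)
    (h₂ : p'.2 = l.1 * p'.1 + l.2) (h₃ : p'.2 = l'.1 * p'.1 + l'.2)
    (h₄ : p.2 = l'.1 * p.1 + l'.2) : p = p' ∨ l = l' := by
  have h : (l.1 - l'.1) * (p.1 - p'.1) = 0 := by
    linear_combination h₄ - h₁ + h₂ - h₃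
  rcases mul_eq_zero.1 h with h | h
  · have hl : l.1 = l'.1 := sub_eq_zero.1 h
    exact .inr (Prod.ext hl (by linear_combination h₄ - h₁ - p.1 * h))
  · have hp : p.1 = p'.1 := sub_eq_zero.1 h
    exact .inl (Prod.ext hp (by linear_combination h₁ - h₂ + l.1 * h))

theorem six_le_egirth_biaffine : 6 ≤ (biaffine F).egirth := by
  rw [SimpleGraph.le_egirth]
  intro a w hw
  have h3 := hw.three_le_length
  by_contra! hlt
  have hlt' : w.length < 6 := by exact_mod_cast hlt
  have hnd := hw.support_nodup
  match w, h3, hlt', hnd with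
  | .cons (v := b) hab (.cons (v := c) hbc (.cons hca .nil)), _, _, _ =>
    rcases a with a | a <;> rcases b with b | b <;> rcases c with c | c <;> simp at hab hbc hca
  | .cons (v := b) hab (.cons (v := c) hbc (.cons (v := d) hcd (.cons hda .nil))), _, _, hnd =>
    rcases a with a | a <;> rcases b with b | b <;> rcases c with c | c <;>
      rcases d with d | d <;> simp at hab hbc hcd hda hnd
    · rcases biaffine_eq_or_eq hab hbc hcd hda with h | h <;> simp_all
    · rcases biaffine_eq_or_eq hab hda hcd hbc with h | h <;> simp_all
  | .cons (v := b) hab (.cons (v := c) hbc (.cons (v := d) hcd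
      (.cons (v := e) hde (.cons hea .nil)))), _, _, _ =>
    rcases a with a | a <;> rcases b with b | b <;> rcases c with c | c <;>
      rcases d with d | d <;> rcases e with e | e <;> simp at hab hbc hcd hde hea
  | .cons _ (.cons _ (.cons _ (.cons _ (.cons _ (.cons _ _))))), _, h, _ =>
    simp only [SimpleGraph.Walk.length_cons] at h
    omega

theorem egirth_biaffine_le_six {t : F} (h0 : t ≠ 0) (h1 : t ≠ 1) :
    (biaffine F).egirth ≤ 6 := by
  have h1' : t - 1 ≠ 0 := sub_ne_zero.2 h1
  let w : (biaffine F).Walk (Sum.inl (0, 0)) (Sum.inl (0, 0)) :=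
    .cons (v := Sum.inr (0, 0)) (by simp) <|
    .cons (v := Sum.inl (1, 0)) (by simp) <|
    .cons (v := Sum.inr (t, -t)) (by simp) <|
    .cons (v := Sum.inl (t, t * t - t)) (by simp [sub_eq_add_neg]) <|
    .cons (v := Sum.inr (t - 1, 0)) (by simp [sub_mul]) <|
    .cons (by simp) .nil
  have hw : w.IsCycle :=
    { edges_nodup := by
        simp [w, h0, h0.symm, h1.symm, h1'.symm]
      ne_nil := by simp [w]
      support_nodup := by
        simp [w, h0, h0.symm, h1.symm, h1'.symm] }
  exact SimpleGraph.egirth_le_length hw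

end Biaffine

/-- for every prime power `q ≥ 3`, the graph `B_q` is `q`-regular,
has exactly `2q^2` vertices, and has girth `6`. -/
theorem stmt0 (q : ℕ) (hq : IsPrimePow q) (hq3 : 3 ≤ q)
    (F : Type) [Field F] [Fintype F] (hF : Fintype.card F = q) :
    (∀ v, ndeg (biaffine F) v = q) ∧
    Nat.card ((F × F) ⊕ (F × F)) = 2 * q ^ 2 ∧
    (biaffine F).egirth = 6 := by
  classical
  refine ⟨fun v => ?_, ?_, ?_⟩
  · rw [ndeg_biaffine, Nat.card_eq_fintype_card, hF]
  · rw [Nat.card_eq_fintype_card, Fintype.card_sum, Fintype.card_prod, hF]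
    ring
  · obtain ⟨t, ht⟩ : ∃ t, t ∉ ({0, 1} : Finset F) := by
      by_contra! h
      have hle := (Finset.card_le_card fun t (_ : t ∈ Finset.univ) => h t).trans Finset.card_le_two
      rw [Finset.card_univ] at hle
      omega
    simp only [Finset.mem_insert, Finset.mem_singleton, not_or] at ht
    exact (egirth_biaffine_le_six ht.1 ht.2).antisymm six_le_egirth_biaffine
end

section
/- For every prime power q, the graph B_q is vertex-transitive: for any two vertices u, v of B_q there is a graph automorphism of B_q mapping u to v. -/
open SimpleGraph Sum

/-- Translation of the plane by `(a, c)`, acting on points and on non-vertical lines. -/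
def biaffineTranslation (F : Type) [Field F] (a c : F) : biaffine F ≃g biaffine F where
  toEquiv := Equiv.sumCongr
    { toFun := fun p => (p.1 + a, p.2 + c)
      invFun := fun p => (p.1 - a, p.2 - c)
      left_inv := fun p => by simp
      right_inv := fun p => by simp }
    { toFun := fun l => (l.1, l.2 - l.1 * a + c)
      invFun := fun l => (l.1, l.2 + l.1 * a - c)
      left_inv := fun l => Prod.ext rfl (by ring)
      right_inv := fun l => Prod.ext rfl (by ring) }
  map_rel_iff' := by
    rintro (⟨x, y⟩ | ⟨m, b⟩) (⟨x', y'⟩ | ⟨m', b'⟩) <;>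
      simp [biaffine, biaffineRel] <;> grind

/-- The duality exchanging the point `(x, y)` with the line of slope `x` and
intercept `-y`. -/
def biaffineDuality (F : Type) [Field F] : biaffine F ≃g biaffine F where
  toEquiv := (Equiv.sumComm _ _).trans <| Equiv.sumCongr
    ((Equiv.refl F).prodCongr (Equiv.neg F)) ((Equiv.refl F).prodCongr (Equiv.neg F))
  map_rel_iff' := by
    rintro (⟨x, y⟩ | ⟨m, b⟩) (⟨x', y'⟩ | ⟨m', b'⟩) <;>
      simp [biaffine, biaffineRel] <;> grind

theorem exists_biaffine_iso_origin (F : Type) [Field F] (u : (F × F) ⊕ (F × F)) :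
    ∃ φ : biaffine F ≃g biaffine F, φ (Sum.inl (0, 0)) = u := by
  obtain ⟨a, c⟩ | ⟨m, b⟩ := u
  · exact ⟨biaffineTranslation F a c, by simp [biaffineTranslation]⟩
  · exact ⟨(biaffineTranslation F m (-b)).trans (biaffineDuality F),
      by simp [biaffineTranslation, biaffineDuality]⟩

/-- for every prime power `q`, the graph `B_q` is vertex-transitive. -/
theorem stmt1 (q : ℕ) (hq : IsPrimePow q)
    (F : Type) [Field F] [Fintype F] (hF : Fintype.card F = q)
    (u v : (F × F) ⊕ (F × F)) :
    ∃ φ : biaffine F ≃g biaffine F, φ u = v := by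
  obtain ⟨α, rfl⟩ := exists_biaffine_iso_origin F u
  obtain ⟨β, rfl⟩ := exists_biaffine_iso_origin F v
  exact ⟨α.symm.trans β, by simp⟩
end

section
/- For every prime power q ≥ 2, the graph A_q has 2q^2 + q vertices, every vertex of V_0 has degree q+1, every vertex of V_1 and every added vertex (q,x)_1 has degree q, and A_q has girth 6. -/
open SimpleGraph Sum

/-- The relation defining the incidence graph `A_q` of the affine plane of order `q` over a
finite field `F`.  Vertices `Sum.inl (x,y)` are the points `(x,y)₀`, vertices
`Sum.inr (Sum.inl (m,b))` are the lines `(m,b)₁` with `m ∈ GF(q)`, and vertices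
`Sum.inr (Sum.inr x)` are the added vertical lines `(q,x)₁`.  A point `(x,y)₀` is adjacent
to `(m,b)₁` iff `y = m*x + b`, and to `(q,x')₁` iff `x = x'`. -/
def affineRel (F : Type) [Field F] :
    ((F × F) ⊕ ((F × F) ⊕ F)) → ((F × F) ⊕ ((F × F) ⊕ F)) → Prop
  | Sum.inl (x, y), Sum.inr (Sum.inl (m, b)) => y = m * x + b
  | Sum.inl (x, _), Sum.inr (Sum.inr x') => x = x'
  | _, _ => False

/-- The graph `A_q`. -/
def affine (F : Type) [Field F] : SimpleGraph ((F × F) ⊕ ((F × F) ⊕ F)) :=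
  SimpleGraph.fromRel (affineRel F)

namespace AffineIncidence

variable {F : Type} [Field F]

@[simp] lemma adj_point_point (p r : F × F) : ¬ (affine F).Adj (.inl p) (.inl r) := by
  simp [affine, affineRel]

@[simp] lemma adj_line_line (l n : (F × F) ⊕ F) : ¬ (affine F).Adj (.inr l) (.inr n) := by
  simp [affine, affineRel]

@[simp] lemma adj_point_line (x y m b : F) :
    (affine F).Adj (.inl (x, y)) (.inr (.inl (m, b))) ↔ y = m * x + b := by
  simp [affine, affineRel]

@[simp] lemma adj_point_vertical (x y x' : F) :
    (affine F).Adj (.inl (x, y)) (.inr (.inr x')) ↔ x = x' := by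
  simp [affine, affineRel]

@[simp] lemma adj_line_point (x y m b : F) :
    (affine F).Adj (.inr (.inl (m, b))) (.inl (x, y)) ↔ y = m * x + b := by
  rw [adj_comm, adj_point_line]

@[simp] lemma adj_vertical_point (x y x' : F) :
    (affine F).Adj (.inr (.inr x')) (.inl (x, y)) ↔ x = x' := by
  rw [adj_comm, adj_point_vertical]

/-- The colouring of the vertices of `A_q` by their side of the bipartition. -/
def sideColoring (F : Type) [Field F] : (affine F).Coloring Bool :=
  Coloring.mk Sum.isLeft (by rintro (a | a) (b | b) h <;> simp_all)

lemma even_length {a : (F × F) ⊕ ((F × F) ⊕ F)} (w : (affine F).Walk a a) : Even w.length :=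
  ((sideColoring F).even_length_iff_congr w).2 Iff.rfl

/-- Two distinct points lie on at most one common line. -/
lemma line_unique {p r : F × F} (hpr : p ≠ r) {l n : (F × F) ⊕ F}
    (hpl : (affine F).Adj (.inl p) (.inr l)) (hrl : (affine F).Adj (.inl r) (.inr l))
    (hpn : (affine F).Adj (.inl p) (.inr n)) (hrn : (affine F).Adj (.inl r) (.inr n)) :
    l = n := by
  obtain ⟨x, y⟩ := p
  obtain ⟨x', y'⟩ := r
  rcases l with ⟨m, b⟩ | v <;> rcases n with ⟨m', b'⟩ | v' <;>
    simp only [adj_point_line, adj_point_vertical] at hpl hrl hpn hrn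
  · have hx : x - x' ≠ 0 := by
      rw [sub_ne_zero]
      rintro rfl
      exact hpr (by rw [hpl, hrl])
    have hm : m = m' := by
      apply mul_right_cancel₀ hx
      linear_combination hpn - hpl - hrn + hrl
    subst hm
    simpa using hpl.symm.trans hpn
  · subst hpn hrn
    exact absurd (by rw [hpl, hrl]) hpr
  · subst hpl hrl
    exact absurd (by rw [hpn, hrn]) hpr
  · rw [← hpl, ← hpn]

/-- Two distinct vertices of `A_q` have at most one common neighbour. -/
lemma common_neighbor_unique {a b c d : (F × F) ⊕ ((F × F) ⊕ F)} (hac : a ≠ c)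
    (hab : (affine F).Adj a b) (hcb : (affine F).Adj c b)
    (had : (affine F).Adj a d) (hcd : (affine F).Adj c d) : b = d := by
  rcases a with p | l <;> rcases b with r | n <;> rcases c with s | k <;> rcases d with t | j <;>
    try simp only [adj_point_point, adj_line_line] at hab hcb had hcd
  · rw [line_unique (fun h => hac (by rw [h])) hab hcb had hcd]
  · by_contra hrt
    exact hac (by rw [line_unique (fun h => hrt (by rw [h])) hab.symm had.symm hcb.symm hcd.symm])

lemma length_ne_four {a : (F × F) ⊕ ((F × F) ⊕ F)} {w : (affine F).Walk a a} (hw : w.IsCycle) :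
    w.length ≠ 4 := by
  intro h
  match w, h with
  | .cons h₁ (.cons h₂ (.cons h₃ (.cons h₄ .nil))), _ =>
    have hnd := hw.support_nodup
    simp only [Walk.support_cons, Walk.support_nil, List.tail_cons, List.nodup_cons,
      List.mem_cons, not_or] at hnd
    exact hnd.1.2.1 (common_neighbor_unique (Ne.symm hnd.2.1.2.1) h₁ h₂.symm h₄.symm h₃)

lemma six_le_egirth : 6 ≤ (affine F).egirth := by
  rw [le_egirth]
  intro a w hw
  have h₃ := hw.three_le_length
  have h₄ := length_ne_four hw
  obtain ⟨k, hk⟩ := even_length w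
  exact_mod_cast (by omega : 6 ≤ w.length)

lemma egirth_le_six : (affine F).egirth ≤ 6 := by
  let p : F × F → (F × F) ⊕ ((F × F) ⊕ F) := .inl
  let l : F × F → (F × F) ⊕ ((F × F) ⊕ F) := fun n => .inr (.inl n)
  have h₁ : (affine F).Adj (p (0, 0)) (l (0, 0)) := by simp [p, l]
  have h₂ : (affine F).Adj (l (0, 0)) (p (1, 0)) := by simp [p, l]
  have h₃ : (affine F).Adj (p (1, 0)) (l (-1, 1)) := by simp [p, l]
  have h₄ : (affine F).Adj (l (-1, 1)) (p (0, 1)) := by simp [p, l]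
  have h₅ : (affine F).Adj (p (0, 1)) (.inr (.inr 0)) := by simp [p]
  have h₆ : (affine F).Adj (.inr (.inr 0)) (p (0, 0)) := by simp [p]
  let w := Walk.cons h₁ (.cons h₂ (.cons h₃ (.cons h₄ (.cons h₅ (.cons h₆ .nil)))))
  have hw : w.IsCycle := by
    simp [w, p, l, Walk.cons_isCycle_iff, Walk.cons_isPath_iff]
  exact egirth_le_length hw

lemma neighborSet_point (x y : F) : (affine F).neighborSet (.inl (x, y)) =
    Set.range fun o : Option F => .inr (o.elim (.inr x) fun m => .inl (m, y - m * x)) := by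
  ext (p | ⟨m, b⟩ | v)
  · simp
  · simp [Option.exists, sub_eq_iff_eq_add']
  · simp [Option.exists]

lemma neighborSet_line (m b : F) : (affine F).neighborSet (.inr (.inl (m, b))) =
    Set.range fun x : F => .inl (x, m * x + b) := by
  ext (⟨x, y⟩ | n)
  · simp [eq_comm]
  · simp

lemma neighborSet_vertical (x : F) : (affine F).neighborSet (.inr (.inr x)) =
    Set.range fun y : F => .inl (x, y) := by
  ext (⟨x', y⟩ | n)
  · simp [eq_comm]
  · simp

end AffineIncidence

/-- for every prime power `q ≥ 2`, the graph `A_q` has `2q² + q` vertices,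
every vertex of `V_0` has degree `q+1`, every vertex of `V_1` and every added vertex
`(q,x)₁` has degree `q`, and `A_q` has girth `6`. -/
theorem stmt3 (q : ℕ) (hq : IsPrimePow q) (hq2 : 2 ≤ q)
    (F : Type) [Field F] [Fintype F] (hF : Fintype.card F = q) :
    Nat.card ((F × F) ⊕ ((F × F) ⊕ F)) = 2 * q ^ 2 + q ∧
    (∀ x y : F, ndeg (affine F) (Sum.inl (x, y)) = q + 1) ∧
    (∀ m b : F, ndeg (affine F) (Sum.inr (Sum.inl (m, b))) = q) ∧
    (∀ x : F, ndeg (affine F) (Sum.inr (Sum.inr x)) = q) ∧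
    (affine F).egirth = 6 := by
  have hF' : Nat.card F = q := by rw [Nat.card_eq_fintype_card, hF]
  refine ⟨?_, fun x y => ?_, fun m b => ?_, fun x => ?_,
    le_antisymm AffineIncidence.egirth_le_six AffineIncidence.six_le_egirth⟩
  · simp only [Nat.card_sum, Nat.card_prod, hF']
    ring
  · rw [ndeg, AffineIncidence.neighborSet_point, Set.ncard_range_of_injective,
      Finite.card_option, hF']
    rintro (_ | m) (_ | m') h <;> simp_all
  · rw [ndeg, AffineIncidence.neighborSet_line, Set.ncard_range_of_injective, hF']
    intro x x' h
    simp_all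
  · rw [ndeg, AffineIncidence.neighborSet_vertical, Set.ncard_range_of_injective, hF']
    intro y y' h
    simp_all
end

section
/- For every prime power q ≥ 2, and for any m ∈ GF(q) ∪ {q} and distinct b, b' ∈ GF(q), the vertices (m,b)_1 and (m,b')_1 have no common neighbour in A_q, and their distance in A_q equals 4. -/
open SimpleGraph Sum

theorem affine_adj_isLeft {F : Type} [Field F] {u v : (F × F) ⊕ ((F × F) ⊕ F)}
    (h : (affine F).Adj u v) : v.isLeft = !u.isLeft := by
  rcases u with ⟨x, y⟩ | ⟨m, b⟩ | c <;> rcases v with ⟨x', y'⟩ | ⟨m', b'⟩ | c' <;>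
    simp_all [affine, affineRel]

theorem affine_adj_line_point {F : Type} [Field F] (m b x y : F) :
    (affine F).Adj (inr (inl (m, b))) (inl (x, y)) ↔ y = m * x + b := by
  simp [affine, affineRel]

theorem affine_adj_vertical_point {F : Type} [Field F] (c x y : F) :
    (affine F).Adj (inr (inr c)) (inl (x, y)) ↔ x = c := by
  simp [affine, affineRel]

/-- Distinct lines without a common point that are joined by a walk of length `4` are at
distance `4`. -/
theorem affine_dist_eq_four {F : Type} [Field F] {u v : (F × F) ⊕ ((F × F) ⊕ F)}
    (hne : u ≠ v) (hu : u.isLeft = false) (hv : v.isLeft = false)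
    (hcommon : ¬ ∃ w, (affine F).Adj u w ∧ (affine F).Adj v w)
    (p : (affine F).Walk u v) (hp : p.length = 4) : (affine F).dist u v = 4 := by
  refine le_antisymm (hp ▸ dist_le p) ?_
  obtain ⟨r, hr⟩ := p.reachable.exists_walk_length_eq_dist
  rw [← hr]
  rcases r with _ | ⟨h₁, _ | ⟨h₂, _ | ⟨h₃, _ | ⟨h₄, r⟩⟩⟩⟩
  · exact absurd rfl hne
  · simp_all [affine_adj_isLeft h₁]
  · exact absurd ⟨_, h₁, h₂.symm⟩ hcommon
  · have e₁ := affine_adj_isLeft h₁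
    have e₂ := affine_adj_isLeft h₂
    have e₃ := affine_adj_isLeft h₃
    simp_all
  · simp only [Walk.length_cons]
    omega

/-- for every prime power `q ≥ 2`, any `m ∈ GF(q) ∪ {q}` and distinct
`b, b' ∈ GF(q)`, the vertices `(m,b)₁` and `(m,b')₁` have no common neighbour in `A_q`,
and their distance in `A_q` equals `4`. -/
theorem stmt4 (q : ℕ) (hq : IsPrimePow q) (hq2 : 2 ≤ q)
    (F : Type) [Field F] [Fintype F] (hF : Fintype.card F = q)
    (u v : (F × F) ⊕ ((F × F) ⊕ F))
    (huv : (∃ m b b' : F, b ≠ b' ∧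
              u = Sum.inr (Sum.inl (m, b)) ∧ v = Sum.inr (Sum.inl (m, b'))) ∨
           (∃ b b' : F, b ≠ b' ∧
              u = Sum.inr (Sum.inr b) ∧ v = Sum.inr (Sum.inr b'))) :
    (¬ ∃ w, (affine F).Adj u w ∧ (affine F).Adj v w) ∧
    (affine F).dist u v = 4 := by
  rcases huv with ⟨m, b, b', hb, rfl, rfl⟩ | ⟨b, b', hb, rfl, rfl⟩
  · have hcommon : ¬ ∃ w, (affine F).Adj (inr (inl (m, b))) w ∧
        (affine F).Adj (inr (inl (m, b'))) w := by
      rintro ⟨⟨x, y⟩ | w, h, h'⟩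
      · rw [affine_adj_line_point] at h h'
        exact hb (add_left_cancel (h.symm.trans h'))
      · simpa using affine_adj_isLeft h
    have h₁ := (affine_adj_line_point m b 0 b).2 (by simp)
    have h₂ := (affine_adj_vertical_point 0 0 b).2 rfl
    have h₃ := (affine_adj_vertical_point 0 0 b').2 rfl
    have h₄ := (affine_adj_line_point m b' 0 b').2 (by simp)
    exact ⟨hcommon, affine_dist_eq_four (by simpa using hb) rfl rfl hcommon
      (.cons h₁ (.cons h₂.symm (.cons h₃ (.cons h₄.symm .nil)))) rfl⟩
  · have hcommon : ¬ ∃ w, (affine F).Adj (inr (inr b)) w ∧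
        (affine F).Adj (inr (inr b')) w := by
      rintro ⟨⟨x, y⟩ | w, h, h'⟩
      · rw [affine_adj_vertical_point] at h h'
        exact hb (h.symm.trans h')
      · simpa using affine_adj_isLeft h
    have h₁ := (affine_adj_vertical_point b b 0).2 rfl
    have h₂ := (affine_adj_line_point 0 0 b 0).2 (by simp)
    have h₃ := (affine_adj_line_point 0 0 b' 0).2 (by simp)
    have h₄ := (affine_adj_vertical_point b' b' 0).2 rfl
    exact ⟨hcommon, affine_dist_eq_four (by simpa using hb) rfl rfl hcommon
      (.cons h₁ (.cons h₂.symm (.cons h₃ (.cons h₄.symm .nil)))) rfl⟩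
end

section
/- For every prime power q ≥ 2, the graph R_q has girth 5, has exactly 2q^2 + q = (q+1)(2q−1) + 1 vertices, each vertex (m,0)_1 with m ∈ GF(q) ∪ {q} has degree 2q−1, and every other vertex of R_q has degree q+1. -/
open SimpleGraph Sum

/-- The relation defining the graph `R_q`: the incidence graph `A_q` of the affine plane of
order `q` (points `Sum.inl (x,y)`, lines `Sum.inr (Sum.inl (m,b))` for `m ∈ GF(q)` and
`Sum.inr (Sum.inr x)` for the vertical lines `(q,x)₁`), together with a star inside each
block of lines, centred at `(m,0)₁`, i.e. the extra edges
`(m,0)₁(m,b)₁` for `b ≠ 0` and `m ∈ GF(q) ∪ {q}`. -/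
def starRel (F : Type) [Field F] :
    ((F × F) ⊕ ((F × F) ⊕ F)) → ((F × F) ⊕ ((F × F) ⊕ F)) → Prop
  | Sum.inl (x, y), Sum.inr (Sum.inl (m, b)) => y = m * x + b
  | Sum.inl (x, _), Sum.inr (Sum.inr x') => x = x'
  | Sum.inr (Sum.inl (m, b)), Sum.inr (Sum.inl (m', b')) => m = m' ∧ b = 0 ∧ b' ≠ 0
  | Sum.inr (Sum.inr x), Sum.inr (Sum.inr x') => x = 0 ∧ x' ≠ 0
  | _, _ => False

/-- The graph `R_q`. -/
def Rgraph (F : Type) [Field F] : SimpleGraph ((F × F) ⊕ ((F × F) ⊕ F)) :=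
  SimpleGraph.fromRel (starRel F)

/-- A graph without triangles in which two distinct vertices never have two distinct common
neighbours has girth at least `5`. -/
theorem SimpleGraph.five_le_egirth {V : Type*} (G : SimpleGraph V)
    (h3 : ∀ a b c, G.Adj a b → G.Adj b c → ¬ G.Adj c a)
    (h4 : ∀ a b c d, G.Adj a b → G.Adj b c → G.Adj c d → G.Adj d a → a = c ∨ b = d) :
    5 ≤ G.egirth := by
  rw [SimpleGraph.le_egirth]
  intro a w hw
  by_contra! hlt
  have hlt' : w.length < 5 := by exact_mod_cast hlt
  have h3le := hw.three_le_length
  match w, hw, hlt', h3le with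
  | .cons h₁ (.cons h₂ (.cons h₃ .nil)), _, _, _ => exact h3 _ _ _ h₁ h₂ h₃
  | .cons h₁ (.cons h₂ (.cons h₃ (.cons h₄ .nil))), hw, _, _ =>
    have hnd := hw.support_nodup
    rcases h4 _ _ _ _ h₁ h₂ h₃ h₄ with rfl | rfl <;> simp at hnd
  | .cons _ (.cons _ (.cons _ (.cons _ (.cons _ w)))), _, hlt', _ =>
    simp only [Walk.length_cons] at hlt'
    omega

/-- The degree of `v` is the size of any type parametrizing its neighbours bijectively. -/
theorem ndeg_eq_card {V ι : Type} {G : SimpleGraph V} {v : V} (f : ι → V)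
    (hf : Function.Injective f) (h : ∀ w, G.Adj v w ↔ ∃ i, f i = w) :
    ndeg G v = Nat.card ι := by
  rw [ndeg, show G.neighborSet v = Set.range f from Set.ext h, ← Set.image_univ,
    Set.ncard_image_of_injective _ hf, Set.ncard_univ]

namespace Rgraph

variable {F : Type} [Field F]

@[simp] theorem not_adj_point_point (p p' : F × F) :
    ¬ (Rgraph F).Adj (.inl p) (.inl p') := by
  simp [Rgraph, starRel]

@[simp] theorem adj_point_line (x y m b : F) :
    (Rgraph F).Adj (.inl (x, y)) (.inr (.inl (m, b))) ↔ y = m * x + b := by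
  simp [Rgraph, starRel]

@[simp] theorem adj_line_point (x y m b : F) :
    (Rgraph F).Adj (.inr (.inl (m, b))) (.inl (x, y)) ↔ y = m * x + b := by
  simp [Rgraph, starRel]

@[simp] theorem adj_point_vertical (x y c : F) :
    (Rgraph F).Adj (.inl (x, y)) (.inr (.inr c)) ↔ x = c := by
  simp [Rgraph, starRel]

@[simp] theorem adj_vertical_point (x y c : F) :
    (Rgraph F).Adj (.inr (.inr c)) (.inl (x, y)) ↔ x = c := by
  simp [Rgraph, starRel]

@[simp] theorem adj_line_line (m b m' b' : F) :
    (Rgraph F).Adj (.inr (.inl (m, b))) (.inr (.inl (m', b'))) ↔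
      m = m' ∧ (b = 0 ∧ b' ≠ 0 ∨ b ≠ 0 ∧ b' = 0) := by
  simp only [Rgraph, starRel, fromRel_adj, ne_eq, Sum.inr.injEq, Sum.inl.injEq, Prod.mk.injEq]
  grind

@[simp] theorem not_adj_line_vertical (l : F × F) (c : F) :
    ¬ (Rgraph F).Adj (.inr (.inl l)) (.inr (.inr c)) := by
  simp [Rgraph, starRel]

@[simp] theorem not_adj_vertical_line (l : F × F) (c : F) :
    ¬ (Rgraph F).Adj (.inr (.inr c)) (.inr (.inl l)) := by
  simp [Rgraph, starRel]

@[simp] theorem adj_vertical_vertical (c c' : F) :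
    (Rgraph F).Adj (.inr (.inr c)) (.inr (.inr c')) ↔ c = 0 ∧ c' ≠ 0 ∨ c ≠ 0 ∧ c' = 0 := by
  simp only [Rgraph, starRel, fromRel_adj, ne_eq, Sum.inr.injEq]
  grind

theorem not_adj_of_adj_of_adj (u v w : (F × F) ⊕ ((F × F) ⊕ F)) :
    (Rgraph F).Adj u v → (Rgraph F).Adj v w → ¬ (Rgraph F).Adj w u := by
  rcases u with ⟨x₁, y₁⟩ | ⟨m₁, b₁⟩ | c₁ <;> rcases v with ⟨x₂, y₂⟩ | ⟨m₂, b₂⟩ | c₂ <;>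
    rcases w with ⟨x₃, y₃⟩ | ⟨m₃, b₃⟩ | c₃ <;> simp <;> grind

/-- `R_q` has no cycle of length `4`. -/
theorem eq_or_eq_of_adj (u v w z : (F × F) ⊕ ((F × F) ⊕ F)) :
    (Rgraph F).Adj u v → (Rgraph F).Adj v w → (Rgraph F).Adj w z → (Rgraph F).Adj z u →
      u = w ∨ v = z := by
  rcases u with ⟨x₁, y₁⟩ | ⟨m₁, b₁⟩ | c₁ <;> rcases v with ⟨x₂, y₂⟩ | ⟨m₂, b₂⟩ | c₂ <;>
    rcases w with ⟨x₃, y₃⟩ | ⟨m₃, b₃⟩ | c₃ <;> rcases z with ⟨x₄, y₄⟩ | ⟨m₄, b₄⟩ | c₄ <;>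
    simp <;> grind

theorem egirth_eq_five : (Rgraph F).egirth = 5 := by
  refine le_antisymm ?_ (five_le_egirth _ not_adj_of_adj_of_adj eq_or_eq_of_adj)
  have h₁ : (Rgraph F).Adj (.inl (0, 0)) (.inr (.inl (0, 0))) := by simp
  have h₂ : (Rgraph F).Adj (.inr (.inl (0, 0))) (.inr (.inl (0, 1))) := by simp
  have h₃ : (Rgraph F).Adj (.inr (.inl (0, 1))) (.inl (0, 1)) := by simp
  have h₄ : (Rgraph F).Adj (.inl (0, 1)) (.inr (.inr 0)) := by simp
  have h₅ : (Rgraph F).Adj (.inr (.inr 0)) (.inl (0, 0)) := by simp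
  have hcycle : (Walk.cons h₁ (.cons h₂ (.cons h₃ (.cons h₄ (.cons h₅ .nil))))).IsCycle := by
    simp [Walk.cons_isCycle_iff]
  exact egirth_le_length hcycle

theorem ndeg_point (x y : F) : ndeg (Rgraph F) (.inl (x, y)) = Nat.card (Option F) := by
  refine ndeg_eq_card
    (fun o => o.elim (.inr (.inr x)) fun m => .inr (.inl (m, y - m * x))) ?_ ?_
  · rintro (_ | m) (_ | m') h <;> simp_all
  · rintro (⟨x', y'⟩ | ⟨m, b⟩ | c) <;> simp [Option.exists]
    grind

theorem ndeg_line (m b : F) (hb : b ≠ 0) :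
    ndeg (Rgraph F) (.inr (.inl (m, b))) = Nat.card (Option F) := by
  refine ndeg_eq_card
    (fun o => o.elim (.inr (.inl (m, 0))) fun x => .inl (x, m * x + b)) ?_ ?_
  · rintro (_ | x) (_ | x') h <;> simp_all
  · rintro (⟨x, y⟩ | ⟨m', b'⟩ | c) <;> simp [Option.exists, hb] <;> grind

theorem ndeg_vertical (c : F) (hc : c ≠ 0) :
    ndeg (Rgraph F) (.inr (.inr c)) = Nat.card (Option F) := by
  refine ndeg_eq_card (fun o => o.elim (.inr (.inr 0)) fun y => .inl (c, y)) ?_ ?_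
  · rintro (_ | y) (_ | y') h <;> simp_all
  · rintro (⟨x, y⟩ | ⟨m, b⟩ | c') <;> simp [Option.exists, hc] <;> grind

theorem ndeg_line_zero (m : F) :
    ndeg (Rgraph F) (.inr (.inl (m, 0))) = Nat.card (F ⊕ {b : F // b ≠ 0}) := by
  refine ndeg_eq_card
    (Sum.elim (fun x => .inl (x, m * x)) fun b => .inr (.inl (m, b))) ?_ ?_
  · rintro (x | ⟨b, hb⟩) (x' | ⟨b', hb'⟩) h <;> simp_all
  · rintro (⟨x, y⟩ | ⟨m', b'⟩ | c) <;> simp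
    grind

theorem ndeg_vertical_zero :
    ndeg (Rgraph F) (.inr (.inr 0)) = Nat.card (F ⊕ {c : F // c ≠ 0}) := by
  refine ndeg_eq_card (Sum.elim (fun y => .inl (0, y)) fun c => .inr (.inr c)) ?_ ?_
  · rintro (y | ⟨c, hc⟩) (y' | ⟨c', hc'⟩) h <;> simp_all
  · rintro (⟨x, y⟩ | ⟨m, b⟩ | c) <;> simp
    grind

end Rgraph

/-- for every prime power `q ≥ 2`, the graph `R_q` has girth `5`, has exactly
`2q² + q = (q+1)(2q−1) + 1` vertices, each vertex `(m,0)₁` with `m ∈ GF(q) ∪ {q}` has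
degree `2q−1`, and every other vertex of `R_q` has degree `q+1`. -/
theorem stmt5 (q : ℕ) (hq : IsPrimePow q) (hq2 : 2 ≤ q)
    (F : Type) [Field F] [Fintype F] (hF : Fintype.card F = q) :
    (Rgraph F).egirth = 5 ∧
    Nat.card ((F × F) ⊕ ((F × F) ⊕ F)) = 2 * q ^ 2 + q ∧
    2 * q ^ 2 + q = (q + 1) * (2 * q - 1) + 1 ∧
    (∀ m : F, ndeg (Rgraph F) (Sum.inr (Sum.inl (m, 0))) = 2 * q - 1) ∧
    ndeg (Rgraph F) (Sum.inr (Sum.inr 0)) = 2 * q - 1 ∧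
    (∀ x y : F, ndeg (Rgraph F) (Sum.inl (x, y)) = q + 1) ∧
    (∀ m b : F, b ≠ 0 → ndeg (Rgraph F) (Sum.inr (Sum.inl (m, b))) = q + 1) ∧
    (∀ x : F, x ≠ 0 → ndeg (Rgraph F) (Sum.inr (Sum.inr x)) = q + 1) := by
  have hF' : Nat.card F = q := by rw [Nat.card_eq_fintype_card, hF]
  have hne : Nat.card {a : F // a ≠ 0} = q - 1 := by
    rw [← Nat.card_congr (unitsEquivNeZero (G₀ := F)), Nat.card_units, hF']
  have hsum : Nat.card (F ⊕ {a : F // a ≠ 0}) = 2 * q - 1 := by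
    rw [Nat.card_sum, hF', hne]
    omega
  have hopt : Nat.card (Option F) = q + 1 := by rw [Finite.card_option, hF']
  refine ⟨Rgraph.egirth_eq_five, ?_, ?_, fun m => (Rgraph.ndeg_line_zero m).trans hsum,
    Rgraph.ndeg_vertical_zero.trans hsum, fun x y => (Rgraph.ndeg_point x y).trans hopt,
    fun m b hb => (Rgraph.ndeg_line m b hb).trans hopt,
    fun x hx => (Rgraph.ndeg_vertical x hx).trans hopt⟩
  · rw [Nat.card_sum, Nat.card_sum, Nat.card_prod, hF']
    ring
  · obtain ⟨k, rfl⟩ := Nat.exists_eq_add_of_le' hq2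
    rw [show 2 * (k + 2) - 1 = 2 * k + 3 by omega]
    ring
end

section
/- For every prime power q ≥ 3 and r = q+1, the minimum number of vertices of a simple graph whose set of vertex degrees is exactly {r, 2r−3} and whose girth is 5 equals r(2r−3) + 1; that is, there exists such a graph with r(2r−3)+1 vertices, and every graph with degree set {r, 2r−3} and girth 5 has at least r(2r−3)+1 vertices. -/
open SimpleGraph

/-- The degree set of a graph: the set of degrees of its vertices. -/
def degreeSet' {V : Type} (G : SimpleGraph V) : Set ℕ :=
  {d | ∃ v, ndeg G v = d}

/-- The set of orders of finite graphs with degree set exactly `D` and girth `5`. -/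
def cageOrders (D : Set ℕ) : Set ℕ :=
  {n | ∃ (V : Type) (G : SimpleGraph V), Finite V ∧ Nat.card V = n ∧
        G.egirth = 5 ∧ degreeSet' G = D}

/-- A graph has girth at least five iff it has neither triangles nor quadrangles. -/
lemma five_le_egirth_iff {V : Type*} (G : SimpleGraph V) :
    5 ≤ G.egirth ↔ (∀ a b c, G.Adj a b → G.Adj b c → ¬ G.Adj c a) ∧
      ∀ a b c d, G.Adj a b → G.Adj b c → G.Adj c d → G.Adj d a → a ≠ c → b = d := by
  rw [le_egirth]
  constructor
  · intro h
    constructor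
    · intro a b c hab hbc hca
      have hc : (Walk.cons hab (Walk.cons hbc (Walk.cons hca Walk.nil))).IsCycle := by
        have := hab.ne
        have := hbc.ne
        have := hca.ne
        rw [Walk.isCycle_def]
        refine ⟨?_, by simp, ?_⟩
        · rw [Walk.isTrail_def]
          simp
          grind
        · simp
          grind
      have := h _ _ hc
      simp only [Walk.length_cons, Walk.length_nil] at this
      norm_cast at this
    · intro a b c d hab hbc hcd hda hac
      by_contra hbd
      have hc : (Walk.cons hab (Walk.cons hbc
          (Walk.cons hcd (Walk.cons hda Walk.nil)))).IsCycle := by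
        have := hab.ne
        have := hbc.ne
        have := hcd.ne
        have := hda.ne
        rw [Walk.isCycle_def]
        refine ⟨?_, by simp, ?_⟩
        · rw [Walk.isTrail_def]
          simp
          grind
        · simp
          grind
      have := h _ _ hc
      simp only [Walk.length_cons, Walk.length_nil] at this
      norm_cast at this
  · rintro ⟨h3, h4⟩ a w hw
    by_contra hlt
    have hl := hw.three_le_length
    have hlt' : w.length < 5 := by
      rw [not_le] at hlt
      exact_mod_cast hlt
    match w, hw, hl, hlt' with
    | .cons hab (.cons hbc (.cons hca .nil)), _, _, _ => exact h3 _ _ _ hab hbc hca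
    | .cons (v := b) hab (.cons (v := c) hbc (.cons (v := d) hcd (.cons hda .nil))), hw, _, _ =>
      have hn := hw.support_nodup
      simp at hn
      have : a ≠ c := by grind
      have := h4 _ _ _ _ hab hbc hcd hda this
      grind

/-- The Moore-type bound for graphs of girth at least five, around a vertex `v`. -/
lemma mul_ndeg_add_one_le_card {V : Type} [Finite V] (G : SimpleGraph V) (hG : 5 ≤ G.egirth)
    {r : ℕ} (hr : ∀ u, r ≤ ndeg G u) (v : V) : r * ndeg G v + 1 ≤ Nat.card V := by
  classical
  have := Fintype.ofFinite V
  obtain ⟨h3, h4⟩ := (five_le_egirth_iff G).1 hG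
  have hdeg : ∀ u, ndeg G u = (G.neighborFinset u).card := fun u => by
    rw [ndeg, neighborFinset_def, Set.ncard_eq_toFinset_card']
  let B : V → Finset V := fun u => insert u ((G.neighborFinset u).erase v)
  have hB : ∀ u ∈ G.neighborFinset v, r ≤ (B u).card := by
    intro u hu
    have hu' : v ∈ G.neighborFinset u := by
      simpa using ((G.mem_neighborFinset v u).1 hu).symm
    have := hr u
    rw [hdeg] at this
    have h0 := Finset.card_pos.2 ⟨v, hu'⟩
    rw [Finset.card_insert_of_notMem (by simp), Finset.card_erase_of_mem hu']
    omega
  have hdisj : Set.PairwiseDisjoint (↑(G.neighborFinset v) : Set V) B := by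
    intro u hu u' hu' hne
    rw [Function.onFun, Finset.disjoint_left]
    intro x hx hx'
    simp only [Finset.mem_coe, mem_neighborFinset] at hu hu'
    simp only [B, Finset.mem_insert, Finset.mem_erase, mem_neighborFinset] at hx hx'
    rcases hx with rfl | ⟨hxv, hx⟩ <;> rcases hx' with rfl | ⟨hxv', hx'⟩
    · exact hne rfl
    · exact h3 _ _ _ hu' hx' hu.symm
    · exact h3 _ _ _ hu hx hu'.symm
    · exact hne (h4 _ _ _ _ hu hx hx'.symm hu'.symm (Ne.symm hxv))
  have hsub : (G.neighborFinset v).biUnion B ⊆ Finset.univ.erase v := by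
    intro x hx
    simp only [Finset.mem_biUnion, mem_neighborFinset, B, Finset.mem_insert,
      Finset.mem_erase] at hx
    obtain ⟨u, hu, rfl | hx⟩ := hx
    · simpa using hu.ne'
    · simpa using hx.1
  have hle := Finset.card_le_card hsub
  rw [Finset.card_biUnion hdisj, Finset.card_erase_of_mem (Finset.mem_univ v),
    Finset.card_univ] at hle
  have hsum := Finset.card_nsmul_le_sum _ _ _ hB
  have : 0 < Fintype.card V := Fintype.card_pos_iff.2 ⟨v⟩
  rw [Nat.card_eq_fintype_card, hdeg, mul_comm]
  rw [smul_eq_mul] at hsum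
  omega

section AffinePlane

variable {F : Type} [Field F]

/-- The intercept of the line of slope `s` through a point of the affine plane over `F`; the slope
`none` is that of the vertical lines. -/
def intercept : Option F → F × F → F
  | none, p => p.1
  | some m, p => p.2 - m * p.1

/-- The parametrization of the line of slope `s` and intercept `c`. -/
def linePoint : Option F → F → F → F × F
  | none, c, t => (c, t)
  | some m, c, t => (t, m * t + c)

lemma intercept_linePoint (s : Option F) (c t : F) : intercept s (linePoint s c t) = c := by
  cases s <;> simp [intercept, linePoint]

lemma linePoint_injective (s : Option F) (c : F) : Function.Injective (linePoint s c) := by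
  intro t t' h
  cases s <;> simp [linePoint] at h
  · exact h
  · exact h.1

lemma exists_linePoint_eq {s : Option F} {c : F} {p : F × F} (h : intercept s p = c) :
    ∃ t, linePoint s c t = p := by
  subst h
  cases s with
  | none => exact ⟨p.2, rfl⟩
  | some m => exact ⟨p.1, by ext <;> simp [linePoint, intercept]⟩

lemma eq_of_intercept_eq {s t : Option F} {p p' : F × F} (hst : s ≠ t)
    (hs : intercept s p = intercept s p') (ht : intercept t p = intercept t p') : p = p' := by
  obtain ⟨x, y⟩ := p
  obtain ⟨x', y'⟩ := p'
  cases s with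
  | none =>
    cases t with
    | none => exact absurd rfl hst
    | some m =>
      simp only [intercept] at hs ht
      subst hs
      simpa using ht
  | some m =>
    cases t with
    | none =>
      simp only [intercept] at hs ht
      subst ht
      simpa using hs
    | some n =>
      simp only [intercept] at hs ht
      have hmn : m - n ≠ 0 := sub_ne_zero.2 fun h => hst (by rw [h])
      have hx : x = x' := mul_left_cancel₀ hmn (by linear_combination ht - hs)
      subst hx
      simpa using hs

/-- The incidence graph of the affine plane over `F`, a line being given by its slope and its
intercept, together with a star on each parallel class, centred at the line of intercept `0`. -/
def affineStarGraph (F : Type) [Field F] : SimpleGraph ((F × F) ⊕ (Option F × F)) where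
  Adj
    | .inl _, .inl _ => False
    | .inl p, .inr l => intercept l.1 p = l.2
    | .inr l, .inl p => intercept l.1 p = l.2
    | .inr l, .inr l' => l.1 = l'.1 ∧ (l.2 = 0 ∧ l'.2 ≠ 0 ∨ l.2 ≠ 0 ∧ l'.2 = 0)
  symm := ⟨by
    rintro (p | l) (p' | l') h
    · exact h
    · exact h
    · exact h
    · exact ⟨h.1.symm, h.2.symm.imp And.symm And.symm⟩⟩
  loopless := ⟨by
    rintro (p | l) h
    · exact h
    · exact h.2.elim (fun h => h.2 h.1) (fun h => h.1 h.2)⟩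

@[simp] lemma affineStarGraph_adj_inl_inl (p p' : F × F) :
    (affineStarGraph F).Adj (.inl p) (.inl p') ↔ False := Iff.rfl

@[simp] lemma affineStarGraph_adj_inl_inr (p : F × F) (s : Option F) (c : F) :
    (affineStarGraph F).Adj (.inl p) (.inr (s, c)) ↔ intercept s p = c := Iff.rfl

@[simp] lemma affineStarGraph_adj_inr_inl (p : F × F) (s : Option F) (c : F) :
    (affineStarGraph F).Adj (.inr (s, c)) (.inl p) ↔ intercept s p = c := Iff.rfl

@[simp] lemma affineStarGraph_adj_inr_inr (s s' : Option F) (c c' : F) :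
    (affineStarGraph F).Adj (.inr (s, c)) (.inr (s', c')) ↔
      s = s' ∧ (c = 0 ∧ c' ≠ 0 ∨ c ≠ 0 ∧ c' = 0) := Iff.rfl

lemma five_le_egirth_affineStarGraph : 5 ≤ (affineStarGraph F).egirth := by
  rw [five_le_egirth_iff]
  constructor
  · rintro (a | ⟨s, a⟩) (b | ⟨t, b⟩) (c | ⟨u, c⟩) <;> simp <;> grind
  · rintro (a | ⟨s, a⟩) (b | ⟨t, b⟩) (c | ⟨u, c⟩) (d | ⟨v, d⟩) <;> simp <;>
      grind [eq_of_intercept_eq]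

lemma egirth_affineStarGraph : (affineStarGraph F).egirth = 5 := by
  refine le_antisymm ?_ five_le_egirth_affineStarGraph
  have h₁ : (affineStarGraph F).Adj (.inl (0, 0)) (.inr (none, 0)) := by simp [intercept]
  have h₂ : (affineStarGraph F).Adj (.inr (none, 0)) (.inr (none, 1)) := by simp
  have h₃ : (affineStarGraph F).Adj (.inr (none, 1)) (.inl (1, 0)) := by simp [intercept]
  have h₄ : (affineStarGraph F).Adj (.inl (1, 0)) (.inr (some 0, 0)) := by simp [intercept]
  have h₅ : (affineStarGraph F).Adj (.inr (some 0, 0)) (.inl (0, 0)) := by simp [intercept]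
  have hc : (Walk.cons h₁ (.cons h₂ (.cons h₃ (.cons h₄ (.cons h₅ .nil))))).IsCycle := by
    rw [Walk.isCycle_def, Walk.isTrail_def]
    simp
  simpa using egirth_le_length hc

lemma ndeg_affineStarGraph_inl [Finite F] (p : F × F) :
    ndeg (affineStarGraph F) (.inl p) = Nat.card F + 1 := by
  have h : (affineStarGraph F).neighborSet (.inl p) =
      Set.range fun s : Option F => Sum.inr (s, intercept s p) := by
    ext (x | ⟨s, c⟩) <;> simp
  rw [ndeg, h, ← Nat.card_coe_set_eq, Nat.card_range_of_injective, Finite.card_option]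
  intro s s' h
  simp at h
  exact h.1

lemma ndeg_affineStarGraph_inr_of_ne_zero [Finite F] (s : Option F) {c : F} (hc : c ≠ 0) :
    ndeg (affineStarGraph F) (.inr (s, c)) = Nat.card F + 1 := by
  have h : (affineStarGraph F).neighborSet (.inr (s, c)) =
      Set.range fun t : Option F =>
        t.elim (Sum.inr (s, 0)) fun x => Sum.inl (linePoint s c x) := by
    ext (x | ⟨s', c'⟩)
    · simp only [mem_neighborSet, affineStarGraph_adj_inr_inl, Set.mem_range, Option.exists]
      simp only [Option.elim, reduceCtorEq, Sum.inl.injEq, false_or]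
      exact ⟨exists_linePoint_eq, fun ⟨t, ht⟩ => ht ▸ intercept_linePoint s c t⟩
    · simp [Option.exists, hc]
      grind
  rw [ndeg, h, ← Nat.card_coe_set_eq, Nat.card_range_of_injective, Finite.card_option]
  rintro (_ | x) (_ | y) h <;> simp at h ⊢
  exact linePoint_injective s c h

lemma ndeg_affineStarGraph_inr_zero [Finite F] (s : Option F) :
    ndeg (affineStarGraph F) (.inr (s, 0)) = 2 * Nat.card F - 1 := by
  classical
  have := Fintype.ofFinite F
  have h : (affineStarGraph F).neighborSet (.inr (s, 0)) =
      Set.range (Sum.elim (fun x : F => Sum.inl (linePoint s 0 x))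
        fun c : {c : F // c ≠ 0} => Sum.inr (s, c.1)) := by
    ext (x | ⟨s', c'⟩)
    · simp only [mem_neighborSet, affineStarGraph_adj_inr_inl, Set.mem_range, Sum.exists]
      simp only [Sum.elim_inl, Sum.elim_inr, reduceCtorEq, Sum.inl.injEq, exists_false, or_false]
      exact ⟨exists_linePoint_eq, fun ⟨t, ht⟩ => ht ▸ intercept_linePoint s 0 t⟩
    · simp [and_comm]
  rw [ndeg, h, ← Nat.card_coe_set_eq, Nat.card_range_of_injective, Nat.card_sum]
  · have hpos : 0 < Nat.card F := Nat.card_pos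
    rw [Nat.card_eq_fintype_card, Nat.card_eq_fintype_card, Fintype.card_subtype_compl,
      Fintype.card_subtype_eq]
    rw [Nat.card_eq_fintype_card] at hpos
    omega
  · rintro (x | x) (y | y) h <;> simp at h ⊢
    · exact linePoint_injective s 0 h
    · exact Subtype.ext h

lemma degreeSet'_affineStarGraph [Finite F] :
    degreeSet' (affineStarGraph F) = {Nat.card F + 1, 2 * Nat.card F - 1} := by
  ext d
  simp only [degreeSet', Set.mem_ofPred_eq, Set.mem_insert_iff, Set.mem_singleton_iff]
  constructor
  · rintro ⟨p | ⟨s, c⟩, rfl⟩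
    · exact .inl (ndeg_affineStarGraph_inl p)
    · by_cases hc : c = 0
      · subst hc
        exact .inr (ndeg_affineStarGraph_inr_zero s)
      · exact .inl (ndeg_affineStarGraph_inr_of_ne_zero s hc)
  · rintro (rfl | rfl)
    · exact ⟨.inl 0, ndeg_affineStarGraph_inl 0⟩
    · exact ⟨.inr (none, 0), ndeg_affineStarGraph_inr_zero none⟩

end AffinePlane

/-- for every prime power `q ≥ 3` and `r = q+1`, the minimum order of a graph
with degree set `{r, 2r−3}` and girth `5` is `r(2r−3) + 1`. -/
theorem stmt6 (q r : ℕ) (hq : IsPrimePow q) (hq3 : 3 ≤ q) (hr : r = q + 1) :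
    IsLeast (cageOrders {r, 2 * r - 3}) (r * (2 * r - 3) + 1) := by
  subst hr
  constructor
  · obtain ⟨p, k, hp, hk, rfl⟩ := (isPrimePow_nat_iff q).1 hq
    have : Fact p.Prime := ⟨hp⟩
    have hcard : Nat.card (GaloisField p k) = p ^ k := GaloisField.card p k hk.ne'
    refine ⟨_, affineStarGraph (GaloisField p k), inferInstance, ?_, egirth_affineStarGraph, ?_⟩
    · rw [Nat.card_sum, Nat.card_prod, Nat.card_prod, Finite.card_option, hcard]
      generalize p ^ k = q at *
      obtain ⟨m, rfl⟩ : ∃ m, q = m + 3 := ⟨q - 3, by omega⟩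
      rw [show 2 * (m + 3 + 1) - 3 = 2 * m + 5 by omega]
      ring
    · rw [degreeSet'_affineStarGraph, hcard]
      congr 2
  · rintro n ⟨V, G, _, rfl, hg, hD⟩
    obtain ⟨v, hv⟩ : 2 * (q + 1) - 3 ∈ degreeSet' G := by simp [hD]
    rw [← hv]
    refine mul_ndeg_add_one_le_card G hg.ge (fun u => ?_) v
    have hu : ndeg G u ∈ degreeSet' G := ⟨u, rfl⟩
    rw [hD] at hu
    rcases hu with hu | hu
    · exact hu.ge
    · rw [Set.mem_singleton_iff] at hu
      omega
end

section
/- For every q = 2^s with s ≥ 2 and r = q+1, there exist at least q+1 pairwise non-isomorphic graphs, each of which has girth 5, exactly r(2r−3)+1 = 2q^2+q vertices, and degree set {r, 2r−3}; moreover, for each t with 0 ≤ t ≤ q one of these graphs has exactly t+1 vertices of degree 2r−3 and all its other vertices of degree r. -/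
open SimpleGraph

section AffinePlane

variable {F : Type} [Field F]

/-- The second coordinate of the line of direction `d` through the point `p`. -/
def lineThrough (p : F × F) : Option F → F
  | none => p.1
  | some m => p.2 - m * p.1

theorem eq_of_lineThrough_eq {p p' : F × F} {d d' : Option F} (hd : d ≠ d')
    (h : lineThrough p d = lineThrough p' d) (h' : lineThrough p d' = lineThrough p' d') :
    p = p' := by
  obtain ⟨x, y⟩ := p
  obtain ⟨x', y'⟩ := p'
  cases d with
  | none =>
    cases d' with
    | none => exact absurd rfl hd
    | some m =>
      simp only [lineThrough] at h h'
      subst h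
      simpa using h'
  | some n =>
    cases d' with
    | none =>
      simp only [lineThrough] at h h'
      subst h'
      simpa using h
    | some m =>
      simp only [lineThrough] at h h'
      have hmn : n - m ≠ 0 := sub_ne_zero.2 fun e => hd (by rw [e])
      have hx : (n - m) * (x - x') = 0 := by linear_combination h' - h
      have hxx : x = x' := sub_eq_zero.1 ((mul_eq_zero.1 hx).resolve_left hmn)
      subst hxx
      simpa using h

theorem ncard_setOf_lineThrough_eq (d : Option F) (b : F) :
    {p : F × F | lineThrough p d = b}.ncard = Nat.card F := by
  cases d with
  | none =>
    have : {p : F × F | lineThrough p none = b} = Set.range fun y : F => (b, y) := by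
      ext ⟨x, y⟩
      simp [lineThrough, eq_comm]
    rw [this, ← Set.image_univ, Set.ncard_image_of_injective _ (Prod.mk_right_injective b),
      Set.ncard_univ]
  | some m =>
    have : {p : F × F | lineThrough p (some m) = b} =
        Set.range fun x : F => (x, m * x + b) := by
      ext ⟨x, y⟩
      simp [lineThrough, sub_eq_iff_eq_add', eq_comm (b := y)]
    rw [this, ← Set.image_univ, Set.ncard_image_of_injective _ fun x y h => congrArg Prod.fst h,
      Set.ncard_univ]

/-- Adjacency inside the parallel class of direction `d`: a star centred at `0` when `d ∈ S`,
and the matching `b ↦ b + 1` otherwise. -/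
def ParallelAdj (S : Set (Option F)) (d : Option F) (b b' : F) : Prop :=
  (d ∈ S ∧ b ≠ b' ∧ (b = 0 ∨ b' = 0)) ∨ (d ∉ S ∧ b' = b + 1)

/-- Adjacency in the incidence graph of the affine plane over `F`, amalgamated with a star or a
matching on each parallel class. -/
def AmalgamAdj (S : Set (Option F)) :
    (F × F) ⊕ (Option F × F) → (F × F) ⊕ (Option F × F) → Prop
  | .inl _, .inl _ => False
  | .inl p, .inr l => lineThrough p l.1 = l.2
  | .inr l, .inl p => lineThrough p l.1 = l.2
  | .inr l, .inr l' => l.1 = l'.1 ∧ ParallelAdj S l.1 l.2 l'.2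

variable {S : Set (Option F)} {d : Option F}

theorem ParallelAdj.ne {b b' : F} (h : ParallelAdj S d b b') : b ≠ b' := by
  rcases h with ⟨-, hne, -⟩ | ⟨-, rfl⟩
  · exact hne
  · simp

theorem parallelAdj_zero_one : ParallelAdj S d 0 1 := by
  by_cases h : d ∈ S
  · exact .inl ⟨h, zero_ne_one, .inl rfl⟩
  · exact .inr ⟨h, (zero_add 1).symm⟩

variable [CharP F 2]

theorem ParallelAdj.symm {b b' : F} (h : ParallelAdj S d b b') : ParallelAdj S d b' b := by
  rcases h with ⟨h, hne, h0⟩ | ⟨h, rfl⟩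
  · exact .inl ⟨h, hne.symm, h0.symm⟩
  · exact .inr ⟨h, by rw [add_assoc, CharTwo.add_self_eq_zero, add_zero]⟩

theorem ParallelAdj.not_path {a b c e : F} (hac : a ≠ c) (hbe : b ≠ e)
    (h₁ : ParallelAdj S d a b) (h₂ : ParallelAdj S d b c) (h₃ : ParallelAdj S d e a) :
    False := by
  have := CharTwo.add_self_eq_zero (1 : F)
  unfold ParallelAdj at *
  grind

variable (S) in
/-- The incidence graph of the affine plane over `F`, amalgamated with stars on the parallel
classes in `S` and perfect matchings on the other ones. -/
def amalgam : SimpleGraph ((F × F) ⊕ (Option F × F)) where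
  Adj := AmalgamAdj S
  symm := ⟨by
    rintro (p | ⟨d, b⟩) (p' | ⟨d', b'⟩) h
    · exact h
    · exact h
    · exact h
    · obtain ⟨rfl, h⟩ := h
      exact ⟨rfl, h.symm⟩⟩
  loopless := ⟨by
    rintro (p | ⟨d, b⟩) h
    · exact h
    · exact h.2.ne rfl⟩

theorem amalgam_not_triangle {u v w : (F × F) ⊕ (Option F × F)} (h : (amalgam S).Adj u v)
    (h' : (amalgam S).Adj v w) (h'' : (amalgam S).Adj w u) : False := by
  rcases u with p | ⟨d, b⟩ <;> rcases v with p' | ⟨d', b'⟩ <;> rcases w with p'' | ⟨d'', b''⟩ <;>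
    simp only [amalgam, AmalgamAdj] at h h' h''
  · obtain ⟨rfl, h'⟩ := h'
    exact h'.ne (h.symm.trans h'')
  · obtain ⟨rfl, h''⟩ := h''
    exact h''.ne (h'.symm.trans h)
  · obtain ⟨rfl, h⟩ := h
    exact h.ne (h''.symm.trans h')
  · obtain ⟨rfl, h⟩ := h
    obtain ⟨rfl, h'⟩ := h'
    exact h.not_path h''.2.symm.ne h'.ne h' h''.2

theorem amalgam_not_square {u v w x : (F × F) ⊕ (Option F × F)} (huw : u ≠ w) (hvx : v ≠ x)
    (h₁ : (amalgam S).Adj u v) (h₂ : (amalgam S).Adj v w) (h₃ : (amalgam S).Adj w x)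
    (h₄ : (amalgam S).Adj x u) : False := by
  have key : ∀ {p p' : F × F} {l l' : Option F × F}, p ≠ p' → l ≠ l' →
      lineThrough p l.1 = l.2 → lineThrough p' l.1 = l.2 →
      lineThrough p l'.1 = l'.2 → lineThrough p' l'.1 = l'.2 → False := by
    rintro p p' ⟨d, b⟩ ⟨d', b'⟩ hp hl h₁ h₂ h₃ h₄
    refine hp (eq_of_lineThrough_eq (d := d) (d' := d') ?_ (h₁.trans h₂.symm) (h₃.trans h₄.symm))
    rintro rfl
    exact hl (Prod.ext rfl (h₁.symm.trans h₃))
  rcases u with p | ⟨d, b⟩ <;> rcases v with p' | ⟨d', b'⟩ <;> rcases w with p'' | ⟨d'', b''⟩ <;>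
    rcases x with p₃ | ⟨d₃, b₃⟩ <;> simp only [amalgam, AmalgamAdj] at h₁ h₂ h₃ h₄
  · exact key (ne_of_apply_ne _ huw) (ne_of_apply_ne _ hvx) h₁ h₂ h₄ h₃
  · grind
  · exact key (ne_of_apply_ne _ hvx) (ne_of_apply_ne _ huw) h₁ h₄ h₂ h₃
  · grind
  · grind
  · grind
  · obtain ⟨rfl, h₁⟩ := h₁
    obtain ⟨rfl, h₂⟩ := h₂
    obtain ⟨rfl, -⟩ := h₃
    exact h₁.not_path (fun e => huw (by rw [e])) (fun e => hvx (by rw [e])) h₂ h₄.2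

end AffinePlane

theorem SimpleGraph.five_le_egirth_s8 {V : Type*} {G : SimpleGraph V}
    (h₃ : ∀ u v w, G.Adj u v → G.Adj v w → G.Adj w u → False)
    (h₄ : ∀ u v w x, u ≠ w → v ≠ x → G.Adj u v → G.Adj v w → G.Adj w x → G.Adj x u → False) :
    5 ≤ G.egirth := by
  rw [le_egirth]
  intro a w hw
  by_contra! hlt
  have hlt : w.length < 5 := by exact_mod_cast hlt
  have hge := hw.three_le_length
  cases w with
  | nil => simp at hge
  | @cons _ b _ hab w =>
  cases w with
  | nil => simp at hge
  | @cons _ c _ hbc w =>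
  cases w with
  | nil => simp at hge
  | @cons _ d _ hcd w =>
  cases w with
  | nil => exact h₃ _ _ _ hab hbc hcd
  | @cons _ e _ hde w =>
  cases w with
  | nil =>
    have := hw.support_nodup
    simp at this
    refine h₄ _ _ _ _ ?_ ?_ hab hbc hcd hde <;> grind
  | cons h w =>
    simp only [Walk.length_cons] at hlt
    omega

theorem egirth_amalgam {F : Type} [Field F] [CharP F 2] (S : Set (Option F)) :
    (amalgam S).egirth = 5 := by
  refine le_antisymm ?_ (five_le_egirth_s8 (fun _ _ _ => amalgam_not_triangle)
    fun _ _ _ _ => amalgam_not_square)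
  let l₀ : (F × F) ⊕ (Option F × F) := .inr (none, 0)
  let l₁ : (F × F) ⊕ (Option F × F) := .inr (none, 1)
  let m : (F × F) ⊕ (Option F × F) := .inr (some 0, 0)
  let p₀ : (F × F) ⊕ (Option F × F) := .inl (0, 0)
  let p₁ : (F × F) ⊕ (Option F × F) := .inl (1, 0)
  have h₁ : (amalgam S).Adj l₀ l₁ := ⟨rfl, parallelAdj_zero_one⟩
  have h₂ : (amalgam S).Adj l₁ p₁ := rfl
  have h₃ : (amalgam S).Adj p₁ m := by simp [amalgam, AmalgamAdj, p₁, m, lineThrough]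
  have h₄ : (amalgam S).Adj m p₀ := by simp [amalgam, AmalgamAdj, p₀, m, lineThrough]
  have h₅ : (amalgam S).Adj p₀ l₀ := rfl
  let w := Walk.cons h₁ (.cons h₂ (.cons h₃ (.cons h₄ (.cons h₅ .nil))))
  have hw : w.IsCycle := by
    rw [Walk.cons_isCycle_iff]
    simp [l₀, l₁, m, p₀, p₁]
  have := egirth_le_length hw
  exact this

section Degrees

variable {F : Type} [Field F] [CharP F 2] {S : Set (Option F)}

theorem ndeg_amalgam_inl [Finite F] (p : F × F) :
    ndeg (amalgam S) (.inl p) = Nat.card F + 1 := by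
  have : (amalgam S).neighborSet (.inl p) =
      Set.range fun d : Option F => .inr (d, lineThrough p d) := by
    ext (p' | ⟨d, b⟩) <;> simp [amalgam, AmalgamAdj]
  rw [ndeg, this, ← Set.image_univ, Set.ncard_image_of_injective, Set.ncard_univ,
    Finite.card_option]
  intro d d' h
  simpa using congrArg Prod.fst (Sum.inr_injective h)

theorem ndeg_amalgam_inr [Finite F] (d : Option F) (b : F) :
    ndeg (amalgam S) (.inr (d, b)) = Nat.card F + {b' | ParallelAdj S d b b'}.ncard := by
  have : (amalgam S).neighborSet (.inr (d, b)) =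
      Sum.inl '' {p : F × F | lineThrough p d = b} ∪
        (fun b' => Sum.inr (d, b')) '' {b' | ParallelAdj S d b b'} := by
    ext (p' | ⟨d', b'⟩) <;> simp [amalgam, AmalgamAdj]
    grind
  rw [ndeg, this, Set.ncard_union_eq, Set.ncard_image_of_injective _ Sum.inl_injective,
    Set.ncard_image_of_injective, ncard_setOf_lineThrough_eq]
  · intro b b' h
    simpa using h
  · rw [Set.disjoint_left]
    rintro _ ⟨p, -, rfl⟩ ⟨b', -, h⟩
    simp at h

theorem ndeg_amalgam_center [Finite F] {d : Option F} (hd : d ∈ S) :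
    ndeg (amalgam S) (.inr (d, 0)) = 2 * Nat.card F - 1 := by
  have : {b' : F | ParallelAdj S d 0 b'} = {0}ᶜ := by
    ext b
    simp [ParallelAdj, hd, eq_comm]
  rw [ndeg_amalgam_inr, this, Set.ncard_compl, Set.ncard_singleton]
  have := Nat.card_pos (α := F)
  omega

theorem ndeg_amalgam_of_not_center [Finite F] {d : Option F} {b : F} (h : ¬(d ∈ S ∧ b = 0)) :
    ndeg (amalgam S) (.inr (d, b)) = Nat.card F + 1 := by
  have : ∃ c, {b' : F | ParallelAdj S d b b'} = {c} := by
    by_cases hd : d ∈ S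
    · refine ⟨0, ?_⟩
      ext b'
      simp only [ParallelAdj, Set.mem_ofPred_eq, Set.mem_singleton_iff]
      grind
    · exact ⟨b + 1, by simp [ParallelAdj, hd]⟩
  obtain ⟨c, hc⟩ := this
  rw [ndeg_amalgam_inr, hc, Set.ncard_singleton]

theorem setOf_ndeg_amalgam_eq [Finite F] (hF : 2 < Nat.card F) :
    {v | ndeg (amalgam S) v = 2 * Nat.card F - 1} = (fun d => .inr (d, 0)) '' S := by
  ext (p | ⟨d, b⟩)
  · simp [ndeg_amalgam_inl]
    omega
  · by_cases h : d ∈ S ∧ b = 0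
    · obtain ⟨hd, rfl⟩ := h
      simp [ndeg_amalgam_center hd, hd]
    · simp [ndeg_amalgam_of_not_center h]
      grind

theorem ndeg_amalgam_eq_or [Finite F] (v : (F × F) ⊕ (Option F × F)) :
    ndeg (amalgam S) v = 2 * Nat.card F - 1 ∨ ndeg (amalgam S) v = Nat.card F + 1 := by
  rcases v with p | ⟨d, b⟩
  · exact .inr (ndeg_amalgam_inl p)
  · by_cases h : d ∈ S ∧ b = 0
    · obtain ⟨hd, rfl⟩ := h
      exact .inl (ndeg_amalgam_center hd)
    · exact .inr (ndeg_amalgam_of_not_center h)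

end Degrees

theorem ndeg_iso {V W : Type} {G : SimpleGraph V} {H : SimpleGraph W} (e : G ≃g H) (v : V) :
    ndeg H (e v) = ndeg G v := by
  rw [ndeg, ndeg, ← Nat.card_coe_set_eq, ← Nat.card_coe_set_eq]
  exact (Nat.card_congr (e.mapNeighborSet v)).symm

theorem ncard_setOf_ndeg_eq_of_iso {V W : Type} {G : SimpleGraph V} {H : SimpleGraph W}
    (e : G ≃g H) (k : ℕ) : {v | ndeg G v = k}.ncard = {w | ndeg H w = k}.ncard := by
  have : {v | ndeg G v = k} = e ⁻¹' {w | ndeg H w = k} := by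
    ext v
    simp [ndeg_iso]
  rw [this]
  exact Set.ncard_preimage_of_injective_subset_range e.injective (by simp [e.surjective.range_eq])

/-- for every `q = 2^s` with `s ≥ 2` and `r = q+1`, there exist `q+1` pairwise
non-isomorphic graphs, each of girth `5`, with exactly `r(2r−3)+1 = 2q²+q` vertices and
degree set `{r, 2r−3}`; moreover the `t`-th one (for `0 ≤ t ≤ q`) has exactly `t+1`
vertices of degree `2r−3` and all its other vertices of degree `r`. -/
theorem stmt8 (s q r : ℕ) (hs : 2 ≤ s) (hq : q = 2 ^ s) (hr : r = q + 1) :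
    ∃ (V : Fin (q + 1) → Type) (G : ∀ t, SimpleGraph (V t)),
      (∀ t : Fin (q + 1),
        Finite (V t) ∧
        (G t).egirth = 5 ∧
        Nat.card (V t) = r * (2 * r - 3) + 1 ∧
        r * (2 * r - 3) + 1 = 2 * q ^ 2 + q ∧
        degreeSet' (G t) = {r, 2 * r - 3} ∧
        Set.ncard {v : V t | ndeg (G t) v = 2 * r - 3} = (t : ℕ) + 1 ∧
        (∀ v : V t, ndeg (G t) v = 2 * r - 3 ∨ ndeg (G t) v = r)) ∧
      (∀ i j : Fin (q + 1), i ≠ j → IsEmpty ((G i) ≃g (G j))) := by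
  have : Fact (Nat.Prime 2) := ⟨Nat.prime_two⟩
  have hF : Nat.card (GaloisField 2 s) = q := by rw [GaloisField.card 2 s (by omega), hq]
  have hfin : Finite (GaloisField 2 s) := Nat.finite_of_card_ne_zero (by rw [hF, hq]; positivity)
  have hq4 : 4 ≤ q := hq ▸ Nat.pow_le_pow_right two_pos hs
  have hr3 : 2 * r - 3 = 2 * q - 1 := by omega
  have hS (t : Fin (q + 1)) : ∃ S : Set (Option (GaloisField 2 s)), S.ncard = t + 1 := by
    obtain ⟨S, -, hS⟩ := Set.exists_subset_card_eq
      (s := (Set.univ : Set (Option (GaloisField 2 s)))) (n := t + 1)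
      (by rw [Set.ncard_univ, Finite.card_option, hF]; omega)
    exact ⟨S, hS⟩
  choose S hS using hS
  have hcount (t : Fin (q + 1)) :
      {v | ndeg (amalgam (S t)) v = 2 * r - 3}.ncard = (t : ℕ) + 1 := by
    rw [hr3, show 2 * q - 1 = 2 * Nat.card (GaloisField 2 s) - 1 by rw [hF],
      setOf_ndeg_amalgam_eq (by omega), Set.ncard_image_of_injective, hS]
    intro d d' h
    simpa using h
  have hdeg (t : Fin (q + 1)) (v) :
      ndeg (amalgam (S t)) v = 2 * r - 3 ∨ ndeg (amalgam (S t)) v = r := by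
    have := ndeg_amalgam_eq_or (S := S t) v
    rwa [hF, ← hr3, ← hr] at this
  have horder : r * (2 * r - 3) + 1 = 2 * q ^ 2 + q := by
    obtain ⟨k, rfl⟩ : ∃ k, q = k + 1 := ⟨q - 1, by omega⟩
    rw [hr3, hr, show 2 * (k + 1) - 1 = 2 * k + 1 by omega]
    ring
  refine ⟨fun _ => _, fun t => amalgam (S t), fun t => ⟨inferInstance, egirth_amalgam _, ?_,
    horder, ?_, hcount t, hdeg t⟩, fun i j hij => ⟨fun e => hij ?_⟩⟩
  · rw [horder, Nat.card_sum, Nat.card_prod, Nat.card_prod, Finite.card_option, hF]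
    ring
  · ext k
    constructor
    · rintro ⟨v, rfl⟩
      exact (hdeg t v).symm
    · rintro (rfl | rfl)
      · exact ⟨.inl 0, by rw [ndeg_amalgam_inl, hF, hr]⟩
      · exact (Set.nonempty_of_ncard_ne_zero (by rw [hcount t]; omega) :
          {v | ndeg (amalgam (S t)) v = 2 * r - 3}.Nonempty)
  · have := ncard_setOf_ndeg_eq_of_iso e (2 * r - 3)
    rw [hcount, hcount] at this
    exact Fin.ext (by omega)
end

section
/- Let q be a prime power, let 0 ≤ u_0 < u_1 < q−1, and let U_0, U_1 ⊆ GF(q)∖{0} with |U_0| = u_0 and |U_1| = u_1. Then the graph B_q(u_0,u_1), obtained from B_q by deleting all blocks P_x with x ∈ U_0 and all blocks L_m with m ∈ U_1, has 2q^2 − q(u_0+u_1) vertices and degree set {q−u_0, q−u_1}: every deleted-side-incident vertex of V_0 has degree q−u_1 and every remaining vertex of V_1 has degree q−u_0. -/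
open SimpleGraph Sum

/-- The vertices kept after Reduction 2: delete all blocks `P_x` with `x ∈ U₀` and all
blocks `L_m` with `m ∈ U₁`. -/
def keep2 (F : Type) [Field F] (U0 U1 : Finset F) : ((F × F) ⊕ (F × F)) → Prop
  | Sum.inl (x, _) => x ∉ U0
  | Sum.inr (m, _) => m ∉ U1

theorem ndeg_induce {V : Type} (G : SimpleGraph V) (s : Set V) (v : s) :
    ndeg (G.induce s) v = (G.neighborSet v ∩ s).ncard := by
  rw [ndeg, ← Set.ncard_image_of_injective _ Subtype.val_injective]
  congr 1
  ext w
  simp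

theorem ncard_compl_coe_finset {α : Type*} [Fintype α] (U : Finset α) :
    {a | a ∉ U}.ncard = Fintype.card α - U.card := by
  classical
  rw [← Finset.card_compl, ← Set.ncard_coe_finset]
  congr 1
  ext a
  simp

theorem ndeg_keep2_inl {F : Type} [Field F] [Fintype F] (U0 U1 : Finset F)
    (p : F × F) (hp : keep2 F U0 U1 (Sum.inl p)) :
    ndeg ((biaffine F).induce {v | keep2 F U0 U1 v}) ⟨Sum.inl p, hp⟩ =
      Fintype.card F - U1.card := by
  have hinj : Function.Injective
      (fun m : F => (Sum.inr (m, p.2 - m * p.1) : (F × F) ⊕ (F × F))) := by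
    intro a b h
    simp only [Sum.inr.injEq, Prod.mk.injEq] at h
    exact h.1
  rw [ndeg_induce, ← ncard_compl_coe_finset, ← Set.ncard_image_of_injective _ hinj]
  congr 1
  ext w
  obtain ⟨x, y⟩ := p
  rcases w with ⟨a, b⟩ | ⟨m, b⟩
  · simp [biaffine, biaffineRel]
  · simp only [Set.mem_inter_iff, mem_neighborSet, biaffine, fromRel_adj, biaffineRel,
      Set.mem_ofPred_eq, keep2, Set.mem_image, Sum.inr.injEq, Prod.mk.injEq]
    grind

theorem ndeg_keep2_inr {F : Type} [Field F] [Fintype F] (U0 U1 : Finset F)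
    (p : F × F) (hp : keep2 F U0 U1 (Sum.inr p)) :
    ndeg ((biaffine F).induce {v | keep2 F U0 U1 v}) ⟨Sum.inr p, hp⟩ =
      Fintype.card F - U0.card := by
  have hinj : Function.Injective
      (fun x : F => (Sum.inl (x, p.1 * x + p.2) : (F × F) ⊕ (F × F))) := by
    intro a b h
    simp only [Sum.inl.injEq, Prod.mk.injEq] at h
    exact h.1
  rw [ndeg_induce, ← ncard_compl_coe_finset, ← Set.ncard_image_of_injective _ hinj]
  congr 1
  ext w
  obtain ⟨m, b⟩ := p
  rcases w with ⟨x, y⟩ | ⟨a, b⟩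
  · simp only [Set.mem_inter_iff, mem_neighborSet, biaffine, fromRel_adj, biaffineRel,
      Set.mem_ofPred_eq, keep2, Set.mem_image, Sum.inl.injEq, Prod.mk.injEq]
    grind
  · simp [biaffine, biaffineRel]

theorem card_keep2 {F : Type} [Field F] [Fintype F] (U0 U1 : Finset F) :
    Nat.card {v // keep2 F U0 U1 v} =
      (Fintype.card F - U0.card) * Fintype.card F +
        (Fintype.card F - U1.card) * Fintype.card F := by
  classical
  have h : ∀ v, v ∈ (U0ᶜ ×ˢ (Finset.univ : Finset F)).disjSum
      (U1ᶜ ×ˢ (Finset.univ : Finset F)) ↔ keep2 F U0 U1 v := by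
    rintro (⟨x, y⟩ | ⟨m, b⟩) <;> simp [keep2]
  rw [Nat.subtype_card _ h]
  simp [Finset.card_compl]

/-- for a prime power `q`, `0 ≤ u₀ < u₁ < q−1` and `U₀, U₁ ⊆ GF(q)∖{0}`
with `|U₀| = u₀`, `|U₁| = u₁`, the graph `B_q(u₀,u₁)` obtained by deleting all blocks
`P_x`, `x ∈ U₀`, and `L_m`, `m ∈ U₁`, has `2q² − q(u₀+u₁)` vertices and degree set
`{q−u₀, q−u₁}`: every remaining vertex of `V₀` has degree `q−u₁` and every remaining
vertex of `V₁` has degree `q−u₀`. -/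
theorem stmt10 (q u0 u1 : ℕ) (hq : IsPrimePow q) (h01 : u0 < u1) (h1q : u1 < q - 1)
    (F : Type) [Field F] [Fintype F] [DecidableEq F] (hF : Fintype.card F = q)
    (U0 U1 : Finset F) (hU0 : (0 : F) ∉ U0) (hU1 : (0 : F) ∉ U1)
    (hc0 : U0.card = u0) (hc1 : U1.card = u1) :
    Nat.card {v // keep2 F U0 U1 v} = 2 * q ^ 2 - q * (u0 + u1) ∧
    degreeSet' ((biaffine F).induce (setOf (keep2 F U0 U1))) = {q - u0, q - u1} ∧
    (∀ (v : {v // keep2 F U0 U1 v}) (p : F × F),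
      v.val = Sum.inl p → ndeg ((biaffine F).induce (setOf (keep2 F U0 U1))) v = q - u1) ∧
    (∀ (v : {v // keep2 F U0 U1 v}) (p : F × F),
      v.val = Sum.inr p → ndeg ((biaffine F).induce (setOf (keep2 F U0 U1))) v = q - u0) := by
  subst hF hc0 hc1
  have hinl : ∀ (v : {v // keep2 F U0 U1 v}) (p : F × F), v.val = Sum.inl p →
      ndeg ((biaffine F).induce {v | keep2 F U0 U1 v}) v = Fintype.card F - U1.card := by
    rintro ⟨_, hv⟩ p rfl
    exact ndeg_keep2_inl U0 U1 p hv
  have hinr : ∀ (v : {v // keep2 F U0 U1 v}) (p : F × F), v.val = Sum.inr p →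
      ndeg ((biaffine F).induce {v | keep2 F U0 U1 v}) v = Fintype.card F - U0.card := by
    rintro ⟨_, hv⟩ p rfl
    exact ndeg_keep2_inr U0 U1 p hv
  refine ⟨?_, ?_, hinl, hinr⟩
  · rw [card_keep2, ← Nat.add_mul]
    have h : Fintype.card F - U0.card + (Fintype.card F - U1.card) =
        2 * Fintype.card F - (U0.card + U1.card) := by omega
    rw [h, Nat.sub_mul]
    congr 1 <;> ring
  · ext d
    simp only [degreeSet', Set.mem_ofPred_eq, Set.mem_insert_iff, Set.mem_singleton_iff]
    constructor
    · rintro ⟨⟨p | p, hv⟩, rfl⟩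
      · exact Or.inr (hinl ⟨Sum.inl p, hv⟩ p rfl)
      · exact Or.inl (hinr ⟨Sum.inr p, hv⟩ p rfl)
    · rintro (rfl | rfl)
      · exact ⟨⟨Sum.inr (0, 0), hU1⟩, hinr ⟨Sum.inr (0, 0), hU1⟩ _ rfl⟩
      · exact ⟨⟨Sum.inl (0, 0), hU0⟩, hinl ⟨Sum.inl (0, 0), hU0⟩ _ rfl⟩
end

section
/- Let G be a finite simple graph of girth 5 whose degree set is D = {a_1, ..., a_k} with 2 ≤ a_1 < a_2 < ... < a_k. Then G has at least 1 + a_1·a_k vertices. -/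
open SimpleGraph

namespace SimpleGraph

variable {V : Type*} {G : SimpleGraph V}

/-- A graph of extended girth at least `4` has no triangles. -/
lemma not_adj_of_four_le_egirth (hG : 4 ≤ G.egirth) {x y z : V}
    (hxy : G.Adj x y) (hyz : G.Adj y z) : ¬ G.Adj z x := by
  intro hzx
  have hw : (Walk.cons hxy (.cons hyz (.cons hzx .nil))).IsCycle := by
    have := hxy.ne
    have := hyz.ne
    have := hzx.ne
    exact
      { edges_nodup := by aesop
        ne_nil := by simp
        support_nodup := by aesop }
  have h := hG.trans (egirth_le_length hw)
  simp only [Walk.length_cons, Walk.length_nil] at h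
  exact absurd h (by decide)

/-- In a graph of extended girth at least `5`, distinct vertices have at most one common
neighbour. -/
lemma eq_of_common_adj_of_five_le_egirth (hG : 5 ≤ G.egirth) {x y u v : V} (hxy : x ≠ y)
    (hux : G.Adj u x) (huy : G.Adj u y) (hvx : G.Adj v x) (hvy : G.Adj v y) : u = v := by
  by_contra huv
  have hw : (Walk.cons hux (.cons hvx.symm (.cons hvy (.cons huy.symm .nil)))).IsCycle := by
    have := hux.ne
    have := huy.ne
    have := hvx.ne
    have := hvy.ne
    exact
      { edges_nodup := by
          simp only [Walk.edges_cons, Walk.edges_nil, List.nodup_cons, List.mem_cons,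
            Sym2.eq_iff, List.not_mem_nil, List.nodup_nil]
          grind
        ne_nil := by simp
        support_nodup := by
          simp only [Walk.support_cons, Walk.support_nil, List.tail_cons, List.nodup_cons,
            List.mem_cons, List.not_mem_nil, List.nodup_nil]
          grind }
  have h := hG.trans (egirth_le_length hw)
  simp only [Walk.length_cons, Walk.length_nil] at h
  exact absurd h (by decide)

/-- Counting the vertices at distance at most `2` from `v` in a graph of girth at least `5`. -/
lemma one_add_sum_degree_le_card [Fintype V] [DecidableEq V] [DecidableRel G.Adj]
    (hG : 5 ≤ G.egirth) (v : V) :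
    1 + ∑ u ∈ G.neighborFinset v, G.degree u ≤ Fintype.card V := by
  have hG' : 4 ≤ G.egirth := le_trans (by decide) hG
  let S : V → Finset V := fun u ↦ insert u ((G.neighborFinset u).erase v)
  have hcard : ∀ u ∈ G.neighborFinset v, (S u).card = G.degree u := by
    intro u hu
    have hvu : G.Adj v u := by simpa using hu
    have hpos : 0 < G.degree u := (G.degree_pos_iff_exists_adj u).2 ⟨v, hvu.symm⟩
    rw [Finset.card_insert_of_notMem (by simp), Finset.card_erase_of_mem (by simpa using hvu.symm),
      card_neighborFinset_eq_degree]
    lia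
  have hdisj : (G.neighborFinset v : Set V).PairwiseDisjoint S := by
    intro u hu w hw huw
    have hvu : G.Adj v u := by simpa using hu
    have hvw : G.Adj v w := by simpa using hw
    refine Finset.disjoint_left.2 fun x hxu hxw ↦ ?_
    simp only [S, Finset.mem_insert, Finset.mem_erase, mem_neighborFinset] at hxu hxw
    rcases hxu with rfl | ⟨hxv, hux⟩ <;> rcases hxw with rfl | ⟨hxv', hwx⟩
    · exact huw rfl
    · exact not_adj_of_four_le_egirth hG' hvw hwx hvu.symm
    · exact not_adj_of_four_le_egirth hG' hvu hux hvw.symm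
    · exact hxv (eq_of_common_adj_of_five_le_egirth hG huw hux.symm hwx.symm hvu hvw)
  have hv : v ∉ (G.neighborFinset v).biUnion S := by
    simp only [S, Finset.mem_biUnion, Finset.mem_insert, Finset.mem_erase, mem_neighborFinset]
    rintro ⟨u, hu, rfl | h⟩
    · exact hu.ne rfl
    · exact h.1 rfl
  rw [← Finset.sum_congr rfl hcard, ← Finset.card_biUnion hdisj, add_comm,
    ← Finset.card_insert_of_notMem hv]
  exact Finset.card_le_univ _

end SimpleGraph

lemma ndeg_eq_degree {V : Type} (G : SimpleGraph V) (v : V) [Fintype (G.neighborSet v)] :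
    ndeg G v = G.degree v := by
  rw [ndeg, Set.ncard_eq_toFinset_card', ← card_neighborFinset_eq_degree, neighborFinset]

/-- the `g = 5` case of the lower bound of Downs et al.:
if `G` is a finite simple graph of girth `5` whose degree set has minimum element
`a ≥ 2` and maximum element `b`, then `G` has at least `1 + a·b` vertices. -/
theorem stmt19 (V : Type) [Fintype V] (G : SimpleGraph V)
    (hg : G.egirth = 5) (a b : ℕ)
    (ha : a ∈ degreeSet' G) (hb : b ∈ degreeSet' G)
    (hmin : ∀ d ∈ degreeSet' G, a ≤ d) (hmax : ∀ d ∈ degreeSet' G, d ≤ b)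
    (h2 : 2 ≤ a) :
    1 + a * b ≤ Fintype.card V := by
  classical
  obtain ⟨v, rfl⟩ := hb
  refine le_trans ?_ (one_add_sum_degree_le_card hg.ge v)
  have h := Finset.card_nsmul_le_sum (G.neighborFinset v) (fun u ↦ G.degree u) a
    fun u _ ↦ hmin _ ⟨u, ndeg_eq_degree G u⟩
  rw [card_neighborFinset_eq_degree, smul_eq_mul] at h
  rw [ndeg_eq_degree, mul_comm a]
  lia
end
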